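/- Theorem (Eq₆): Let u_{1,3}, u_{1,4}, u_{1,5} ∈ (0,1) be free parameters and define the remaining dihedral coordinates of M_{0,6} on the standard cell by the chord relations (each u_{i,j} the unique value in (0,1) making 1 - u_{i,j} equal to the product of the coordinates of chords crossing {i,j}). Then Σ_{{i,j} ∈ χ₆} L(u_{i,j}) = 6·L(1), i.e. L(u₁₃)+L(u₂₄)+L(u₃₅)+L(u₄₆)+L(u₁₅)+L(u₂₆)+L(u₁₄)+L(u₂₅)+L(u₃₆) = π². -/

import Mathlib

open Real

/-- The dilogarithm, defined by its power series (convergent for `|x| ≤ 1`). -/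
noncomputable def Li2 (x : ℝ) : ℝ := ∑' k : ℕ, x ^ (k + 1) / ((k : ℝ) + 1) ^ 2

/-- The Rogers dilogarithm `L(x) = Li₂(x) + (1/2)·log x · log (1-x)`.
Since `Real.log 0 = 0`, this formula also gives the standard extended values
`L 0 = 0` and `L 1 = π²/6`. -/
noncomputable def RogersL (x : ℝ) : ℝ := Li2 x + (1 / 2) * Real.log x * Real.log (1 - x)

open Set

theorem continuousOn_Li2 : ContinuousOn Li2 (Icc 0 1) := by
  unfold Li2
  refine continuousOn_tsum (u := fun k : ℕ => 1 / ((k : ℝ) + 1) ^ 2)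
    (fun k => by fun_prop) ?_ ?_
  · have h := (summable_nat_add_iff 1).2 hasSum_zeta_two.summable
    simpa using h
  · intro k x hx
    rw [Real.norm_eq_abs, abs_of_nonneg (by have := hx.1; positivity)]
    gcongr
    exact pow_le_one₀ hx.1 hx.2

theorem continuous_log_mul_log_one_sub :
    Continuous fun x : ℝ => Real.log x * Real.log (1 - x) := by
  have key : ContinuousAt (fun x : ℝ => Real.log x * Real.log (1 - x)) 0 := by
    have hd : DifferentiableAt ℝ (fun x : ℝ => Real.log (1 - x)) 0 :=
      (differentiableAt_id.const_sub 1).log (by norm_num)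
    have h := Real.continuous_mul_log.continuousAt.mul (continuousAt_dslope_same.2 hd)
    refine h.congr (Filter.Eventually.of_forall fun x => ?_)
    have hs := sub_smul_dslope (fun x : ℝ => Real.log (1 - x)) 0 x
    simp only [sub_zero, Real.log_one, smul_eq_mul] at hs
    simp only [Pi.mul_apply, ← hs]
    ring
  refine continuous_iff_continuousAt.2 fun x => ?_
  rcases eq_or_ne x 0 with rfl | h0
  · exact key
  rcases eq_or_ne x 1 with rfl | h1
  · have hc : ContinuousAt (fun x : ℝ => 1 - x) 1 := by fun_prop
    have h := ContinuousAt.comp_of_eq key hc (sub_self 1)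
    refine h.congr (Filter.Eventually.of_forall fun x => ?_)
    simp [mul_comm]
  · have : 1 - x ≠ 0 := sub_ne_zero.2 h1.symm
    fun_prop (disch := assumption)

theorem continuousOn_RogersL : ContinuousOn RogersL (Icc 0 1) := by
  have h := continuousOn_Li2.add
    (continuous_log_mul_log_one_sub.continuousOn.const_smul (1 / 2 : ℝ))
  refine h.congr fun x _ => ?_
  simp [RogersL, mul_assoc]

theorem hasDerivAt_Li2 {x : ℝ} (hx : x ∈ Ioo (0 : ℝ) 1) :
    HasDerivAt Li2 (-Real.log (1 - x) / x) x := by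
  obtain ⟨r, hxr, hr⟩ := exists_between hx.2
  have hr0 : 0 < r := hx.1.trans hxr
  have hd := hasDerivAt_tsum_of_isPreconnected
    (u := fun k : ℕ => r ^ k) (t := Ioo (-r) r)
    (g := fun (k : ℕ) (y : ℝ) => y ^ (k + 1) / ((k : ℝ) + 1) ^ 2)
    (g' := fun (k : ℕ) (y : ℝ) => y ^ k / ((k : ℝ) + 1)) (y₀ := 0) (y := x)
    (summable_geometric_of_lt_one hr0.le hr) isOpen_Ioo isPreconnected_Ioo
    (fun k y _ => by
      have h := (hasDerivAt_pow (k + 1) y).div_const (((k : ℝ) + 1) ^ 2)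
      refine h.congr_deriv ?_
      rw [Nat.add_sub_cancel]
      push_cast
      field_simp)
    (fun k y hy => by
      rw [Real.norm_eq_abs, abs_div, abs_pow, abs_of_pos (by positivity : (0 : ℝ) < k + 1)]
      calc |y| ^ k / ((k : ℝ) + 1) ≤ |y| ^ k :=
            div_le_self (by positivity) (by linarith [(Nat.cast_nonneg k : (0 : ℝ) ≤ k)])
        _ ≤ r ^ k := by gcongr; exact (abs_lt.2 hy).le)
    ⟨by linarith, hr0⟩ (by simp) ⟨by linarith [hx.1], hxr⟩
  have hs := (Real.hasSum_pow_div_log_of_abs_lt_one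
    (abs_lt.2 ⟨by linarith [hx.1], hx.2⟩ : |x| < 1)).div_const x
  have he : ∑' k : ℕ, x ^ k / ((k : ℝ) + 1) = -Real.log (1 - x) / x := by
    rw [← hs.tsum_eq]
    refine tsum_congr fun k => ?_
    have := hx.1.ne'
    field_simp
    ring
  rw [← he]
  exact hd

theorem hasDerivAt_RogersL {x : ℝ} (hx : x ∈ Ioo (0 : ℝ) 1) :
    HasDerivAt RogersL
      (-(1 / 2) * (Real.log (1 - x) / x + Real.log x / (1 - x))) x := by
  have h0 : x ≠ 0 := hx.1.ne'
  have h1 : 1 - x ≠ 0 := (sub_pos.2 hx.2).ne'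
  have h := (hasDerivAt_Li2 hx).add
    (((Real.hasDerivAt_log h0).const_mul (1 / 2)).mul
      (((hasDerivAt_id x).const_sub 1).log h1))
  refine h.congr_deriv ?_
  simp only [id]
  field_simp
  ring

theorem RogersL_zero : RogersL 0 = 0 := by
  simp [RogersL, Li2]

theorem RogersL_one : RogersL 1 = π ^ 2 / 6 := by
  have h := (hasSum_nat_add_iff' 1).2 hasSum_zeta_two
  simp at h
  simp [RogersL, Li2, ← h.tsum_eq]

/-- A function continuous on `[a, b]` with zero derivative inside takes equal endpoint values. -/
theorem eq_of_hasDerivAt_zero {f : ℝ → ℝ} {a b : ℝ} (hab : a < b)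
    (hc : ContinuousOn f (Icc a b)) (hd : ∀ x ∈ Ioo a b, HasDerivAt f 0 x) : f b = f a := by
  obtain ⟨c, -, hs⟩ := exists_hasDerivAt_eq_slope f (fun _ => 0) hab hc hd
  have := sub_pos.2 hab
  field_simp at hs
  linarith

theorem RogersL_add_one_sub {x : ℝ} (hx : x ∈ Ioo (0 : ℝ) 1) :
    RogersL x + RogersL (1 - x) = π ^ 2 / 6 := by
  have h := eq_of_hasDerivAt_zero (f := fun t => RogersL t + RogersL (1 - t)) hx.1
    (by
      refine (continuousOn_RogersL.mono (Icc_subset_Icc le_rfl hx.2.le)).add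
        (continuousOn_RogersL.comp (by fun_prop) ?_)
      intro t ht
      constructor <;> linarith [ht.1, ht.2, hx.2])
    (fun t ht => by
      have ht' : t ∈ Ioo (0 : ℝ) 1 := ⟨ht.1, ht.2.trans hx.2⟩
      have h1 := hasDerivAt_RogersL ht'
      have h2 := hasDerivAt_RogersL (x := 1 - t) ⟨by linarith [ht'.2], by linarith [ht'.1]⟩
      have h3 := h2.comp t ((hasDerivAt_id t).const_sub 1)
      refine (h1.add h3).congr_deriv ?_
      simp only [sub_sub_cancel]
      ring)
  simpa [RogersL_zero, RogersL_one] using h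

theorem RogersL_five_term {x y : ℝ} (hx : x ∈ Ioo (0 : ℝ) 1) (hy : y ∈ Ioo (0 : ℝ) 1) :
    RogersL x + RogersL y + RogersL (1 - x * y) + RogersL ((1 - y) / (1 - x * y)) +
      RogersL ((1 - x) / (1 - x * y)) = π ^ 2 / 2 := by
  obtain ⟨hy0, hy1⟩ := hy
  have hpos : ∀ t, 0 ≤ t → t ≤ x → 0 < 1 - t * y := fun t h0 h1 => by
    nlinarith [hx.2]
  have h := eq_of_hasDerivAt_zero
    (f := fun t => RogersL t + RogersL y + RogersL (1 - t * y) +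
      RogersL ((1 - y) / (1 - t * y)) + RogersL ((1 - t) / (1 - t * y))) hx.1
    (by
      have hne : ∀ t ∈ Icc 0 x, 1 - t * y ≠ 0 := fun t ht => (hpos t ht.1 ht.2).ne'
      refine ((((continuousOn_RogersL.mono (Icc_subset_Icc le_rfl hx.2.le)).add
        continuousOn_const).add (continuousOn_RogersL.comp (by fun_prop) ?_)).add
        (continuousOn_RogersL.comp
          (ContinuousOn.div (by fun_prop) (by fun_prop) hne) ?_)).add
        (continuousOn_RogersL.comp
          (ContinuousOn.div (by fun_prop) (by fun_prop) hne) ?_)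
      all_goals
        intro t ht
        have hp := hpos t ht.1 ht.2
        have ht0 := ht.1
        have ht1 : t ≤ 1 := ht.2.trans hx.2.le
      · exact ⟨hp.le, by nlinarith⟩
      · exact ⟨div_nonneg (by linarith) hp.le, (div_le_one hp).2 (by nlinarith)⟩
      · exact ⟨div_nonneg (by linarith) hp.le, (div_le_one hp).2 (by nlinarith)⟩)
    (fun t ht => by
      have ht0 : 0 < t := ht.1
      have ht1 : t < 1 := ht.2.trans hx.2
      have hp : 0 < 1 - t * y := hpos t ht0.le ht.2.le
      have hty : 0 < t * y := mul_pos ht0 hy0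
      have hq : 0 < 1 - y := sub_pos.2 hy1
      have hr : 0 < 1 - t := sub_pos.2 ht1
      have hm : HasDerivAt (fun t : ℝ => 1 - t * y) (-(1 * y)) t :=
        ((hasDerivAt_id t).mul_const y).const_sub 1
      have e4 : 1 - (1 - y) / (1 - t * y) = y * (1 - t) / (1 - t * y) := by
        rw [eq_div_iff hp.ne', sub_mul, div_mul_cancel₀ _ hp.ne']
        ring
      have e5 : 1 - (1 - t) / (1 - t * y) = t * (1 - y) / (1 - t * y) := by
        rw [eq_div_iff hp.ne', sub_mul, div_mul_cancel₀ _ hp.ne']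
        ring
      have h1 := hasDerivAt_RogersL (x := t) ⟨ht0, ht1⟩
      have h3 := (hasDerivAt_RogersL (x := 1 - t * y) ⟨hp, by linarith⟩).comp t hm
      have h4 := (hasDerivAt_RogersL (x := (1 - y) / (1 - t * y))
        ⟨by positivity, by rw [← sub_pos, e4]; positivity⟩).comp t
        ((hasDerivAt_const t (1 - y)).div hm hp.ne')
      have h5 := (hasDerivAt_RogersL (x := (1 - t) / (1 - t * y))
        ⟨by positivity, by rw [← sub_pos, e5]; positivity⟩).comp t
        (((hasDerivAt_id t).const_sub 1).div hm hp.ne')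
      refine ((((h1.add (hasDerivAt_const t (RogersL y))).add h3).add h4).add h5).congr_deriv ?_
      simp only [id, e4, e5, sub_sub_cancel]
      rw [Real.log_div (by positivity) hp.ne', Real.log_div hq.ne' hp.ne',
        Real.log_div (by positivity) hp.ne', Real.log_div hr.ne' hp.ne',
        Real.log_mul hy0.ne' hr.ne', Real.log_mul ht0.ne' hq.ne',
        Real.log_mul ht0.ne' hy0.ne']
      generalize Real.log (1 - t * y) = lp
      generalize Real.log (1 - t) = lr
      generalize Real.log (1 - y) = lq
      field_simp
      ring)
  have hr := RogersL_add_one_sub (x := y) ⟨hy0, hy1⟩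
  simp [RogersL_zero, RogersL_one] at h
  linarith

/-- The pentagon relation: the Rogers dilogarithms of the dihedral coordinates of `M₀,₅`
sum to `3 L(1)`. -/
theorem RogersL_pentagon {a b c d e : ℝ} (ha : a ∈ Ioo (0 : ℝ) 1) (hb : 0 < b)
    (hc : c ∈ Ioo (0 : ℝ) 1) (hab : b + a * c = 1) (hbc : c + b * d = 1)
    (hae : a + b * e = 1) :
    RogersL a + RogersL b + RogersL c + RogersL d + RogersL e = π ^ 2 / 2 := by
  have h := RogersL_five_term ha hc
  have hb' : 1 - a * c = b := by linarith
  have hd : (1 - c) / b = d := by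
    field_simp
    linarith
  have he : (1 - a) / b = e := by
    field_simp
    linarith
  rw [hb', hd, he] at h
  linarith

/-- (Eq₆): if the nine dihedral coordinates of the standard cell of `M₀,₆`
lie in `(0,1)` and satisfy the nine chord relations
`u_{i,j} + Π_{{k,l} crossing {i,j}} u_{k,l} = 1`, then
`Σ_{{i,j} ∈ χ₆} L(u_{i,j}) = 6 L(1) = π²`. -/
theorem Eq6 (u13 u24 u35 u46 u15 u26 u14 u25 u36 : ℝ)
    (h13 : u13 ∈ Set.Ioo (0 : ℝ) 1) (h24 : u24 ∈ Set.Ioo (0 : ℝ) 1)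
    (h35 : u35 ∈ Set.Ioo (0 : ℝ) 1) (h46 : u46 ∈ Set.Ioo (0 : ℝ) 1)
    (h15 : u15 ∈ Set.Ioo (0 : ℝ) 1) (h26 : u26 ∈ Set.Ioo (0 : ℝ) 1)
    (h14 : u14 ∈ Set.Ioo (0 : ℝ) 1) (h25 : u25 ∈ Set.Ioo (0 : ℝ) 1)
    (h36 : u36 ∈ Set.Ioo (0 : ℝ) 1)
    (r13 : u13 + u24 * u25 * u26 = 1)
    (r24 : u24 + u35 * u36 * u13 = 1)
    (r35 : u35 + u46 * u14 * u24 = 1)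
    (r46 : u46 + u15 * u25 * u35 = 1)
    (r15 : u15 + u26 * u36 * u46 = 1)
    (r26 : u26 + u13 * u14 * u15 = 1)
    (r14 : u14 + u25 * u26 * u35 * u36 = 1)
    (r25 : u25 + u36 * u13 * u46 * u14 = 1)
    (r36 : u36 + u14 * u15 * u24 * u25 = 1) :
    RogersL u13 + RogersL u24 + RogersL u35 + RogersL u46 + RogersL u15 +
      RogersL u26 + RogersL u14 + RogersL u25 + RogersL u36 = π ^ 2 := by
  have e1 : u25 * u26 + u13 * u14 - 1 = -(u13 * u14) * (u36 * u46 + u15 * u25 - 1) := by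
    linear_combination u25 * r26 + r25
  have e2 : u36 * u46 + u15 * u25 - 1 = -(u15 * u25) * (u14 * u24 + u35 * u36 - 1) := by
    linear_combination u36 * r46 + r36
  have e3 : u14 * u24 + u35 * u36 - 1 = -(u35 * u36) * (u25 * u26 + u13 * u14 - 1) := by
    linear_combination u14 * r24 + r14
  have hpos : 0 < 1 + u13 * u14 * (u15 * u25) * (u35 * u36) := by
    have := h13.1
    have := h14.1
    have := h15.1
    have := h25.1
    have := h35.1
    have := h36.1
    positivity
  have q1 : u25 * u26 + u13 * u14 = 1 := by
    have h0 : (u25 * u26 + u13 * u14 - 1) * (1 + u13 * u14 * (u15 * u25) * (u35 * u36)) = 0 := by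
      linear_combination e1 - u13 * u14 * e2 + u13 * u14 * (u15 * u25) * e3
    linarith [(mul_eq_zero.1 h0).resolve_right hpos.ne']
  have q3 : u14 * u24 + u35 * u36 = 1 := by
    rw [q1, sub_self, mul_zero] at e3
    linarith
  have q2 : u36 * u46 + u15 * u25 = 1 := by
    rw [q3, sub_self, mul_zero] at e2
    linarith
  have hm : ∀ {a b : ℝ}, a ∈ Ioo (0 : ℝ) 1 → b ∈ Ioo (0 : ℝ) 1 → a * b ∈ Ioo (0 : ℝ) 1 :=
    fun ha hb => ⟨mul_pos ha.1 hb.1, mul_lt_one_of_nonneg_of_lt_one_left ha.1.le ha.2 hb.2.le⟩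
  have p1 := RogersL_pentagon h14 (hm h25 h26).1 h13 (b := u25 * u26) (d := u24)
    (e := u35 * u36) (by linarith) (by linarith) (by linarith)
  have p2 := RogersL_pentagon h35 (hm h14 h24).1 h36 (b := u14 * u24) (d := u15 * u25)
    (e := u46) (by linarith) (by linarith) (by linarith)
  have p3 := RogersL_pentagon h15 (hm h36 h46).1 h25 (b := u36 * u46) (d := u13 * u14)
    (e := u26) (by linarith) (by linarith) (by linarith)
  have s1 := RogersL_add_one_sub (hm h25 h26)
  have s2 := RogersL_add_one_sub (hm h36 h46)
  have s3 := RogersL_add_one_sub (hm h14 h24)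
  rw [← q1, add_sub_cancel_left] at s1
  rw [← q2, add_sub_cancel_left] at s2
  rw [← q3, add_sub_cancel_left] at s3
  linarith
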